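/- Let S be a 0-left cancellative semigroup with zero admitting least common multiples. Then for every open, maximal string σ in S, the character φ_σ of the semilattice E(S) of constructible sets is an ultracharacter. -/

import Mathlib

/-- A semigroup with zero is `0`-left cancellative if `s*t = s*r ≠ 0` implies `t = r`. -/
def ZeroLeftCancellative (S : Type*) [SemigroupWithZero S] : Prop :=
  ∀ s t r : S, s * t = s * r → s * t ≠ 0 → t = r

/-- `s` divides `t` when `t ∈ {s} ∪ sS`. -/
def Divides {S : Type*} [Mul S] (s t : S) : Prop := t = s ∨ ∃ u, s * u = t

/-- `r` is a least common multiple of `s` and `t` when `sS ∩ tS = rS` and both `s` and `t`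
divide `r`. -/
def IsLCM {S : Type*} [Mul S] (s t r : S) : Prop :=
  ({x | ∃ u, x = s * u} ∩ {x | ∃ u, x = t * u} = {x | ∃ u, x = r * u}) ∧
    Divides s r ∧ Divides t r

/-- The regular representation: `theta s` is the graph of the partial bijection
`θ_s : F_s → E_s`, `x ↦ s*x`, of `S' = S \ {0}`. -/
def theta {S : Type*} [SemigroupWithZero S] (s : S) : S → S → Prop :=
  fun x y => x ≠ 0 ∧ s * x ≠ 0 ∧ y = s * x

/-- The identity partial bijection on a subset `X`, viewed as a relation. -/
def idOn {α : Type*} (X : Set α) : α → α → Prop := fun x y => x = y ∧ x ∈ X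

/-- The inverse subsemigroup of the symmetric inverse semigroup generated by the
partial bijections `π s`, where relations model partial bijections by their graphs:
`Relation.Comp r₁ r₂` applies `r₁` first, and `flip r` is the inverse of `r`. -/
inductive InHull {S α : Type*} (π : S → α → α → Prop) : (α → α → Prop) → Prop
  | base (s : S) : InHull π (π s)
  | inv {r : α → α → Prop} : InHull π r → InHull π (flip r)
  | comp {r₁ r₂ : α → α → Prop} : InHull π r₁ → InHull π r₂ →
      InHull π (Relation.Comp r₁ r₂)

/-- `X ⊆ S'` is constructible when `id_X` belongs to the idempotent semilattice `E(S)`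
of the inverse hull `H(S)` of the regular representation. -/
def Constructible (S : Type*) [SemigroupWithZero S] (X : Set S) : Prop :=
  InHull (theta (S := S)) (idOn X)

/-- A string in `S`: a nonempty subset not containing `0`, closed under divisors,
and directed with respect to divisibility. -/
def IsString {S : Type*} [SemigroupWithZero S] (σ : Set S) : Prop :=
  σ.Nonempty ∧ (0 : S) ∉ σ ∧
  (∀ s t : S, Divides s t → t ∈ σ → s ∈ σ) ∧
  (∀ s₁ ∈ σ, ∀ s₂ ∈ σ, ∃ s ∈ σ, Divides s₁ s ∧ Divides s₂ s)

/-- The character `φ_σ` of the semilattice of constructible sets associated with a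
string `σ`:  `φ_σ(X) = 1` iff `σ ∈ ε(X)`, where the representation `ε` sends a
constructible set `X` to the set of strings asymptotically contained in `X`
(i.e. those strings in which `X ∩ σ` is cofinal for the divisibility order). -/
noncomputable def charOfString {S : Type*} [SemigroupWithZero S] (σ : Set S) :
    Set S → Bool :=
  fun X => @decide (∀ s ∈ σ, ∃ t, t ∈ X ∩ σ ∧ Divides s t) (Classical.propDecidable _)

/-- A character of the semilattice `E(S)` of constructible sets: a nonzero,
zero-preserving, multiplicative `{0,1}`-valued map on constructible sets. -/
def IsCharE (S : Type*) [SemigroupWithZero S] (φ : Set S → Bool) : Prop :=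
  (∃ X : Set S, Constructible S X ∧ φ X = true) ∧
  φ (∅ : Set S) = false ∧
  ∀ X Y : Set S, Constructible S X → Constructible S Y →
    φ (X ∩ Y) = (φ X && φ Y)

/-- Left multiplication by an element of `S` with an external identity adjoined. -/
def IsLeftMul {S : Type*} [Mul S] (a : S → S) : Prop :=
  a = id ∨ ∃ s : S, a = fun x => s * x

namespace IsLeftMul

variable {S : Type*} [SemigroupWithZero S] {a b : S → S}

theorem map_mul (ha : IsLeftMul a) (x w : S) : a (x * w) = a x * w := by
  rcases ha with rfl | ⟨s, rfl⟩
  · rfl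
  · exact (mul_assoc s x w).symm

theorem map_zero (ha : IsLeftMul a) : a 0 = 0 := by
  rcases ha with rfl | ⟨s, rfl⟩
  · rfl
  · exact mul_zero s

theorem comp (ha : IsLeftMul a) (hb : IsLeftMul b) : IsLeftMul (a ∘ b) := by
  rcases ha with rfl | ⟨s, rfl⟩
  · exact hb
  · rcases hb with rfl | ⟨t, rfl⟩
    · exact Or.inr ⟨s, rfl⟩
    · exact Or.inr ⟨s * t, funext fun x => (mul_assoc s t x).symm⟩

theorem cancel (hlc : ZeroLeftCancellative S) (ha : IsLeftMul a) {x y : S}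
    (h : a x = a y) (h0 : a x ≠ 0) : x = y := by
  rcases ha with rfl | ⟨s, rfl⟩
  · exact h
  · exact hlc s x y h h0

end IsLeftMul

theorem Divides.exists_isLeftMul {S : Type*} [SemigroupWithZero S] {s r : S}
    (h : Divides s r) : ∃ p : S → S, IsLeftMul p ∧ ∀ c, s * p c = r * c := by
  rcases h with rfl | ⟨u, rfl⟩
  · exact ⟨id, Or.inl rfl, fun _ => rfl⟩
  · exact ⟨fun x => u * x, Or.inr ⟨u, rfl⟩, fun c => (mul_assoc s u c).symm⟩

theorem Divides.trans {S : Type*} [Semigroup S] {s t r : S}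
    (hst : Divides s t) (htr : Divides t r) : Divides s r := by
  rcases hst with rfl | ⟨u, rfl⟩
  · exact htr
  · rcases htr with rfl | ⟨v, rfl⟩
    · exact Or.inr ⟨u, rfl⟩
    · exact Or.inr ⟨u * v, (mul_assoc s u v).symm⟩

/-- Two left multiplications have a weak pullback in a semigroup with least common multiples. -/
theorem IsLeftMul.exists_pullback {S : Type*} [SemigroupWithZero S]
    (hlc : ZeroLeftCancellative S) (hlcm : ∀ s t : S, ∃ r : S, IsLCM s t r)
    {a b : S → S} (ha : IsLeftMul a) (hb : IsLeftMul b) :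
    ∃ p q : S → S, IsLeftMul p ∧ IsLeftMul q ∧ (∀ c, a (p c) = b (q c)) ∧
      ∀ z z', a z = b z' → a z ≠ 0 → ∃ c, z = p c ∧ z' = q c := by
  rcases ha with rfl | ⟨s, rfl⟩
  · exact ⟨b, id, hb, Or.inl rfl, fun _ => rfl, fun z z' h _ => ⟨z', h, rfl⟩⟩
  rcases hb with rfl | ⟨t, rfl⟩
  · exact ⟨id, fun x => s * x, Or.inl rfl, Or.inr ⟨s, rfl⟩, fun _ => rfl,
      fun z z' h _ => ⟨z, rfl, h.symm⟩⟩
  obtain ⟨r, hr, hsr, htr⟩ := hlcm s t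
  obtain ⟨p, hp, hsp⟩ := hsr.exists_isLeftMul
  obtain ⟨q, hq, htq⟩ := htr.exists_isLeftMul
  refine ⟨p, q, hp, hq, fun c => (hsp c).trans (htq c).symm, fun z z' h h0 => ?_⟩
  dsimp only at h h0
  have hmem : s * z ∈ {x | ∃ u, x = s * u} ∩ {x | ∃ u, x = t * u} := ⟨⟨z, rfl⟩, ⟨z', h⟩⟩
  rw [hr] at hmem
  obtain ⟨c, hc⟩ := hmem
  exact ⟨c, hlc s _ _ (hc.trans (hsp c).symm) h0,
    hlc t _ _ (h.symm.trans (hc.trans (htq c).symm)) (h ▸ h0)⟩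

/-- Normal form of the elements of the inverse hull. -/
theorem InHull.exists_normalForm {S : Type*} [SemigroupWithZero S]
    (hlc : ZeroLeftCancellative S) (hlcm : ∀ s t : S, ∃ r : S, IsLCM s t r)
    {ρ : S → S → Prop} (h : InHull (theta (S := S)) ρ) :
    ∃ (a b : S → S) (F : Set S), IsLeftMul a ∧ IsLeftMul b ∧
      (∀ z w, z * w ∈ F → z ∈ F) ∧ (∀ z ∈ F, a z ≠ 0 ∧ b z ≠ 0) ∧
      ∀ x y, ρ x y ↔ ∃ z ∈ F, x = b z ∧ y = a z := by
  induction h with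
  | base s =>
    refine ⟨fun x => s * x, id, {x | s * x ≠ 0}, Or.inr ⟨s, rfl⟩, Or.inl rfl, ?_, ?_, ?_⟩
    · intro z w hzw hz
      exact hzw (by rw [← mul_assoc, hz, zero_mul])
    · intro z hz
      exact ⟨hz, fun h0 => hz (by rw [show z = 0 from h0, mul_zero])⟩
    · intro x y
      constructor
      · rintro ⟨-, h1, h2⟩
        exact ⟨x, h1, rfl, h2⟩
      · rintro ⟨z, hz, rfl, rfl⟩
        exact ⟨fun h0 => hz (by rw [show x = 0 from h0, mul_zero]), hz, rfl⟩
  | inv _ ih =>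
    obtain ⟨a, b, F, ha, hb, hF, hne, hr⟩ := ih
    refine ⟨b, a, F, hb, ha, hF, fun z hz => (hne z hz).symm, fun x y => ?_⟩
    exact (hr y x).trans ⟨fun ⟨z, hz, h1, h2⟩ => ⟨z, hz, h2, h1⟩,
      fun ⟨z, hz, h1, h2⟩ => ⟨z, hz, h2, h1⟩⟩
  | comp _ _ ih₁ ih₂ =>
    obtain ⟨a, b, F, ha, hb, hF, hne, hr⟩ := ih₁
    obtain ⟨a', b', F', ha', hb', hF', hne', hr'⟩ := ih₂
    obtain ⟨p, q, hp, hq, hpq, hpull⟩ := IsLeftMul.exists_pullback hlc hlcm ha hb'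
    refine ⟨a' ∘ q, b ∘ p, {c | p c ∈ F ∧ q c ∈ F'}, ha'.comp hq, hb.comp hp, ?_, ?_, ?_⟩
    · rintro z w ⟨h1, h2⟩
      rw [hp.map_mul] at h1
      rw [hq.map_mul] at h2
      exact ⟨hF _ _ h1, hF' _ _ h2⟩
    · rintro c ⟨h1, h2⟩
      exact ⟨(hne' _ h2).1, (hne _ h1).2⟩
    · intro x y
      constructor
      · rintro ⟨m, h1, h2⟩
        obtain ⟨z, hz, rfl, rfl⟩ := (hr _ _).1 h1
        obtain ⟨z', hz', h3, rfl⟩ := (hr' _ _).1 h2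
        obtain ⟨c, rfl, rfl⟩ := hpull z z' h3 (hne z hz).1
        exact ⟨c, ⟨hz, hz'⟩, rfl, rfl⟩
      · rintro ⟨c, ⟨h1, h2⟩, rfl, rfl⟩
        exact ⟨a (p c), (hr _ _).2 ⟨_, h1, rfl, rfl⟩, (hr' _ _).2 ⟨_, h2, hpq c, rfl⟩⟩

/-- A constructible set lies in the range of some left multiplication, and within that range
it is closed under left divisors. -/
theorem Constructible.exists_isLeftMul {S : Type*} [SemigroupWithZero S]
    (hlc : ZeroLeftCancellative S) (hlcm : ∀ s t : S, ∃ r : S, IsLCM s t r)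
    {X : Set S} (hX : Constructible S X) :
    ∃ a : S → S, IsLeftMul a ∧ (∀ x ∈ X, x ≠ 0 ∧ x ∈ Set.range a) ∧
      ∀ x ∈ Set.range a, ∀ w, x * w ∈ X → x ∈ X := by
  obtain ⟨a, b, F, ha, -, hF, hne, hr⟩ := InHull.exists_normalForm hlc hlcm hX
  have key : ∀ x ∈ X, ∃ z ∈ F, x = a z := fun x hx => by
    obtain ⟨z, hz, -, h⟩ := (hr x x).1 ⟨rfl, hx⟩
    exact ⟨z, hz, h⟩
  refine ⟨a, ha, fun x hx => ?_, ?_⟩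
  · obtain ⟨z, hz, rfl⟩ := key x hx
    exact ⟨(hne z hz).1, z, rfl⟩
  · rintro _ ⟨z, rfl⟩ w hw
    obtain ⟨z', hz', h⟩ := key _ hw
    rw [← ha.map_mul] at h
    have hzw : z' = z * w := ha.cancel hlc h.symm (hne z' hz').1
    have hz : z ∈ F := hF z w (hzw ▸ hz')
    obtain ⟨h1, h2⟩ := (hr (b z) (a z)).2 ⟨z, hz, rfl, rfl⟩
    exact h1 ▸ h2

/-- The set `E_s = sS \ {0}`. -/
def nonzeroMultiples {S : Type*} [SemigroupWithZero S] (s : S) : Set S :=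
  {y | y ≠ 0 ∧ ∃ z, y = s * z}

theorem constructible_nonzeroMultiples {S : Type*} [SemigroupWithZero S] (s : S) :
    Constructible S (nonzeroMultiples s) := by
  have h : idOn (nonzeroMultiples s) = Relation.Comp (flip (theta s)) (theta s) := by
    funext x y
    apply propext
    constructor
    · rintro ⟨rfl, h0, z, rfl⟩
      have hz : z ≠ 0 := fun hz => h0 (by rw [hz, mul_zero])
      exact ⟨z, ⟨hz, h0, rfl⟩, hz, h0, rfl⟩
    · rintro ⟨z, ⟨-, h0, rfl⟩, -, -, rfl⟩
      exact ⟨rfl, h0, z, rfl⟩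
  unfold Constructible
  rw [h]
  exact (InHull.inv (InHull.base s)).comp (InHull.base s)

theorem idOn_inter {α : Type*} (X Y : Set α) :
    idOn (X ∩ Y) = Relation.Comp (idOn X) (idOn Y) := by
  funext x y
  apply propext
  constructor
  · rintro ⟨rfl, hX, hY⟩
    exact ⟨x, ⟨rfl, hX⟩, rfl, hY⟩
  · rintro ⟨_, ⟨rfl, hX⟩, rfl, hY⟩
    exact ⟨rfl, hX, hY⟩

theorem Constructible.inter {S : Type*} [SemigroupWithZero S] {X Y : Set S}
    (hX : Constructible S X) (hY : Constructible S Y) : Constructible S (X ∩ Y) := by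
  unfold Constructible
  rw [idOn_inter]
  exact InHull.comp hX hY

theorem charOfString_eq_true {S : Type*} [SemigroupWithZero S] {σ X : Set S} :
    charOfString σ X = true ↔ ∀ s ∈ σ, ∃ t, t ∈ X ∩ σ ∧ Divides s t :=
  @decide_eq_true_iff _ (Classical.propDecidable _)

theorem charOfString_nonzeroMultiples {S : Type*} [SemigroupWithZero S] {σ : Set S}
    (hσ : IsString σ) (hopen : ∀ s ∈ σ, ∃ p : S, s * p ∈ σ) {s : S} (hs : s ∈ σ) :
    charOfString σ (nonzeroMultiples s) = true := by
  refine charOfString_eq_true.2 fun t ht => ?_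
  obtain ⟨p, hp⟩ := hopen s hs
  obtain ⟨r, hr, hpr, htr⟩ := hσ.2.2.2 _ hp t ht
  refine ⟨r, ⟨⟨fun h0 => hσ.2.1 (h0 ▸ hr), ?_⟩, hr⟩, htr⟩
  rcases hpr with rfl | ⟨u, rfl⟩
  · exact ⟨p, rfl⟩
  · exact ⟨p * u, mul_assoc s p u⟩

theorem isCharE_charOfString {S : Type*} [SemigroupWithZero S]
    (hlc : ZeroLeftCancellative S) (hlcm : ∀ s t : S, ∃ r : S, IsLCM s t r)
    {σ : Set S} (hσ : IsString σ) (hopen : ∀ s ∈ σ, ∃ p : S, s * p ∈ σ) :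
    IsCharE S (charOfString σ) := by
  obtain ⟨s₀, hs₀⟩ := hσ.1
  refine ⟨⟨_, constructible_nonzeroMultiples s₀,
    charOfString_nonzeroMultiples hσ hopen hs₀⟩, ?_, fun X Y hX _ => ?_⟩
  · rw [Bool.eq_false_iff]
    intro h
    obtain ⟨t, ht, -⟩ := charOfString_eq_true.1 h s₀ hs₀
    exact ht.1
  · rw [Bool.eq_iff_iff, Bool.and_eq_true]
    simp only [charOfString_eq_true]
    constructor
    · intro h
      exact ⟨fun s hs => (h s hs).imp fun t ht => ⟨⟨ht.1.1.1, ht.1.2⟩, ht.2⟩,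
        fun s hs => (h s hs).imp fun t ht => ⟨⟨ht.1.1.2, ht.1.2⟩, ht.2⟩⟩
    · rintro ⟨h1, h2⟩ s hs
      obtain ⟨a, ha, hXa, hdiv⟩ := hX.exists_isLeftMul hlc hlcm
      obtain ⟨t, ⟨htX, htσ⟩, hst⟩ := h1 s hs
      obtain ⟨y, ⟨hyY, hyσ⟩, hty⟩ := h2 t htσ
      refine ⟨y, ⟨⟨?_, hyY⟩, hyσ⟩, hst.trans hty⟩
      rcases hty with rfl | ⟨w, rfl⟩
      · exact htX
      · obtain ⟨x, ⟨hxX, -⟩, hx⟩ := h1 _ hyσ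
        rcases hx with rfl | ⟨v, rfl⟩
        · exact hxX
        · obtain ⟨z, rfl⟩ := (hXa t htX).2
          exact hdiv _ ⟨z * w, ha.map_mul z w⟩ v hxX

namespace IsCharE

variable {S : Type*} [SemigroupWithZero S] {ψ : Set S → Bool}

theorem inter (hψ : IsCharE S ψ) {X Y : Set S} (hX : Constructible S X)
    (hY : Constructible S Y) (h1 : ψ X = true) (h2 : ψ Y = true) : ψ (X ∩ Y) = true := by
  rw [hψ.2.2 X Y hX hY, h1, h2, Bool.and_self]

theorem mono (hψ : IsCharE S ψ) {X Y : Set S} (hX : Constructible S X)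
    (hY : Constructible S Y) (hXY : X ⊆ Y) (h : ψ X = true) : ψ Y = true := by
  have h1 := hψ.2.2 X Y hX hY
  rw [Set.inter_eq_left.2 hXY, h, Bool.true_and] at h1
  exact h1.symm

theorem nonempty (hψ : IsCharE S ψ) {X : Set S} (h : ψ X = true) : X.Nonempty := by
  rw [Set.nonempty_iff_ne_empty]
  rintro rfl
  rw [hψ.2.1] at h
  exact Bool.false_ne_true h

/-- The string associated with a character that does not vanish on all sets `E_s`. -/
theorem isString (hlcm : ∀ s t : S, ∃ r : S, IsLCM s t r) (hψ : IsCharE S ψ)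
    (hne : ∃ s, ψ (nonzeroMultiples s) = true) :
    IsString {s | ψ (nonzeroMultiples s) = true} := by
  refine ⟨hne, ?_, ?_, ?_⟩
  · intro h
    obtain ⟨x, hx, z, rfl⟩ := hψ.nonempty h
    exact hx (zero_mul z)
  · intro s t hst ht
    refine hψ.mono (constructible_nonzeroMultiples t) (constructible_nonzeroMultiples s) ?_ ht
    rintro _ ⟨h0, z, rfl⟩
    rcases hst with rfl | ⟨u, rfl⟩
    · exact ⟨h0, z, rfl⟩
    · exact ⟨h0, u * z, mul_assoc s u z⟩
  · intro s hs t ht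
    obtain ⟨r, hr, hsr, htr⟩ := hlcm s t
    refine ⟨r, ?_, hsr, htr⟩
    have hs' := constructible_nonzeroMultiples s
    have ht' := constructible_nonzeroMultiples t
    refine hψ.mono (hs'.inter ht') (constructible_nonzeroMultiples r) ?_ (hψ.inter hs' ht' hs ht)
    rintro x ⟨⟨h0, h1⟩, -, h2⟩
    refine ⟨h0, ?_⟩
    have hx : x ∈ {x | ∃ u, x = s * u} ∩ {x | ∃ u, x = t * u} := ⟨h1, h2⟩
    rw [hr] at hx
    exact hx

end IsCharE

/-- If `S` is a `0`-left cancellative semigroup admitting least common multiples and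
`σ` is an open, maximal string, then `φ_σ` is an ultracharacter of the semilattice
`E(S)` of constructible sets: it is a character which is maximal for the pointwise
order on characters. -/
theorem strings.openMaximalUltra {S : Type*} [SemigroupWithZero S]
    (hlc : ZeroLeftCancellative S)
    (hlcm : ∀ s t : S, ∃ r : S, IsLCM s t r)
    (σ : Set S) (hσ : IsString σ)
    (hopen : ∀ s ∈ σ, ∃ p : S, s * p ∈ σ)
    (hmax : ∀ τ : Set S, IsString τ → σ ⊆ τ → σ = τ) :
    IsCharE S (charOfString σ) ∧
    ∀ ψ : Set S → Bool, IsCharE S ψ →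
      (∀ X : Set S, Constructible S X → charOfString σ X = true → ψ X = true) →
      ∀ X : Set S, Constructible S X → ψ X = charOfString σ X := by
  refine ⟨isCharE_charOfString hlc hlcm hσ hopen, fun ψ hψ hle X hX => ?_⟩
  rw [Bool.eq_iff_iff]
  refine ⟨fun hψX => ?_, hle X hX⟩
  have hE : ∀ s ∈ σ, ψ (nonzeroMultiples s) = true := fun s hs =>
    hle _ (constructible_nonzeroMultiples s) (charOfString_nonzeroMultiples hσ hopen hs)
  have hσψ : σ = {s | ψ (nonzeroMultiples s) = true} :=
    hmax _ (hψ.isString hlcm (hσ.1.imp hE)) hE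
  obtain ⟨a, ha, hXa, hdiv⟩ := hX.exists_isLeftMul hlc hlcm
  have hmem : ∀ s ∈ σ, s ∈ Set.range a → s ∈ X := by
    intro s hs hsa
    obtain ⟨_, ⟨-, w, rfl⟩, hw⟩ := hψ.nonempty
      (hψ.inter (constructible_nonzeroMultiples s) hX (hE s hs) hψX)
    exact hdiv s hsa w hw
  refine charOfString_eq_true.2 fun s hs => ?_
  rcases ha with rfl | ⟨u, rfl⟩
  · exact ⟨s, ⟨hmem s hs ⟨s, rfl⟩, hs⟩, Or.inl rfl⟩
  · have hu : u ∈ σ := by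
      rw [hσψ]
      refine hψ.mono hX (constructible_nonzeroMultiples u) (fun x hx => ?_) hψX
      obtain ⟨h0, z, hz⟩ := hXa x hx
      exact ⟨h0, z, hz.symm⟩
    obtain ⟨t, ⟨⟨-, z, rfl⟩, htσ⟩, hst⟩ :=
      charOfString_eq_true.1 (charOfString_nonzeroMultiples hσ hopen hu) s hs
    exact ⟨u * z, ⟨hmem _ htσ ⟨z, rfl⟩, htσ⟩, hst⟩
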